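/- arXiv:2512.07035 — 4 statements merged into one kernel-verified Lean document; each statement's English description precedes it below -/
import Mathlib

section
/- Let f: G → Q be a surjective group homomorphism with kernel N, let P_Q and P_N be positive cones of Q and N respectively, each defining a bi-order on Q and N (i.e. invariant under conjugation by Q and N respectively), and let P = f⁻¹(P_Q) ∪ P_N. Then P defines a bi-order on G (equivalently, hPh⁻¹ ⊆ P for all h ∈ G) if and only if hP_Nh⁻¹ ⊆ P_N for all h ∈ G. -/
/-- A positive cone of a group `G`: a subsemigroup `P` such that
`G = P ⊔ P⁻¹ ⊔ {1}` is a disjoint union. -/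
def IsPositiveCone {G : Type*} [Group G] (P : Set G) : Prop :=
  (∀ a ∈ P, ∀ b ∈ P, a * b ∈ P) ∧
  (∀ g : G, g ∈ P ∨ g⁻¹ ∈ P ∨ g = 1) ∧
  (1 : G) ∉ P ∧
  ∀ g ∈ P, g⁻¹ ∉ P

/-- A positive cone of the subgroup `H` of `G`, regarded as a subset of `G`. -/
def IsPositiveConeIn {G : Type*} [Group G] (H : Subgroup G) (P : Set G) : Prop :=
  P ⊆ (H : Set G) ∧
  (∀ a ∈ P, ∀ b ∈ P, a * b ∈ P) ∧
  (∀ h ∈ H, h ∈ P ∨ h⁻¹ ∈ P ∨ h = 1) ∧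
  (1 : G) ∉ P ∧
  ∀ g ∈ P, g⁻¹ ∉ P

/-- A bi-order on a group `G`: a strict total order invariant under both left- and
right-multiplication. -/
def IsBiOrder {G : Type*} [Group G] (r : G → G → Prop) : Prop :=
  (∀ g, ¬ r g g) ∧ (∀ a b c, r a b → r b c → r a c) ∧
  (∀ a b, a ≠ b → r a b ∨ r b a) ∧
  ∀ f f' g h, r g h ↔ r (f * g * f') (f * h * f')

/-- Let `f : G → Q` be surjective with kernel `N`, and let `P_Q`, `P_N` be positive cones
of `Q` and `N` defining bi-orders (i.e. invariant under conjugation by `Q` resp. `N`).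
Then the lexicographic positive cone `P = f⁻¹(P_Q) ∪ P_N` defines a bi-order on `G` iff
`P_N` is invariant under conjugation by all of `G`. -/
theorem lexicographic_biOrder_iff {G Q : Type*} [Group G] [Group Q]
    (f : G →* Q) (hf : Function.Surjective f)
    (P_Q : Set Q) (hPQ : IsPositiveCone P_Q)
    (hPQconj : ∀ q : Q, ∀ p ∈ P_Q, q * p * q⁻¹ ∈ P_Q)
    (P_N : Set G) (hPN : IsPositiveConeIn f.ker P_N)
    (hPNconj : ∀ n ∈ f.ker, ∀ p ∈ P_N, n * p * n⁻¹ ∈ P_N) :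
    IsBiOrder (fun g h : G => g⁻¹ * h ∈ f ⁻¹' P_Q ∪ P_N) ↔
      ∀ h : G, ∀ p ∈ P_N, h * p * h⁻¹ ∈ P_N := by
  obtain ⟨qm, qt, q1, qi⟩ := hPQ
  obtain ⟨ns, nm, nt, n1, ni⟩ := hPN
  have fk : ∀ p ∈ P_N, f p = 1 := fun p hp => ns hp
  constructor
  · rintro ⟨-, -, -, hinv⟩ h p hp
    have h1 := (hinv h h⁻¹ 1 p).1 (by right; simpa using hp)
    rcases h1 with h1 | h1
    · exfalso
      apply q1
      simpa [fk p hp] using h1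
    · simpa using h1
  · intro hc
    have hP : ∀ h p : G, p ∈ f ⁻¹' P_Q ∪ P_N → h * p * h⁻¹ ∈ f ⁻¹' P_Q ∪ P_N := by
      rintro h p (hp | hp)
      · left
        simpa using hPQconj (f h) _ hp
      · right
        exact hc h p hp
    refine ⟨?_, ?_, ?_, ?_⟩
    · intro g hg
      simp only [inv_mul_cancel] at hg
      rcases hg with hg | hg
      · exact q1 (by simpa using hg)
      · exact n1 hg
    · intro a b c hab hbc
      have e : a⁻¹ * c = (a⁻¹ * b) * (b⁻¹ * c) := by group
      simp only [e]
      generalize a⁻¹ * b = x at *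
      generalize b⁻¹ * c = y at *
      rcases hab with hx | hx <;> rcases hbc with hy | hy
      · left
        simpa using qm _ hx _ hy
      · left
        simpa [fk y hy] using hx
      · left
        simpa [fk x hx] using hy
      · right
        exact nm _ hx _ hy
    · intro a b hab
      have e : b⁻¹ * a = (a⁻¹ * b)⁻¹ := by group
      have hne : a⁻¹ * b ≠ 1 := fun h => hab (inv_mul_eq_one.1 h)
      simp only [e]
      generalize a⁻¹ * b = x at *
      rcases qt (f x) with h | h | h
      · exact Or.inl (Or.inl h)
      · exact Or.inr (Or.inl (by simpa using h))
      · rcases nt x h with h | h | h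
        · exact Or.inl (Or.inr h)
        · exact Or.inr (Or.inr h)
        · exact absurd h hne
    · intro u v g h
      have e : (u * g * v)⁻¹ * (u * h * v) = v⁻¹ * (g⁻¹ * h) * v⁻¹⁻¹ := by group
      simp only [e]
      constructor
      · exact hP _ _
      · intro h1
        have h2 := hP v _ h1
        have e2 : v * (v⁻¹ * (g⁻¹ * h) * v⁻¹⁻¹) * v⁻¹ = g⁻¹ * h := by group
        rwa [e2] at h2
end

section
/- Every countable left-orderable group G embeds into the group Homeo⁺(ℝ) of orientation-preserving homeomorphisms of the real line: there exists an injective group homomorphism ρ: G → Homeo⁺(ℝ). Moreover, ρ can be chosen together with an order-preserving map t: (G, ≺) → (ℝ, <) such that ρ(g)(t(h)) = t(gh) for all g, h ∈ G. -/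
/-- A left-order on a group `G`: a strict total order invariant under left-multiplication. -/
def IsLeftOrder {G : Type*} [Group G] (r : G → G → Prop) : Prop :=
  (∀ g, ¬ r g g) ∧ (∀ a b c, r a b → r b c → r a c) ∧
  (∀ a b, a ≠ b → r a b ∨ r b a) ∧
  ∀ f g h, r g h ↔ r (f * g) (f * h)

noncomputable def extR (f : ℚ ≃o ℚ) (x : ℝ) : ℝ := sSup ((fun q : ℚ => (f q : ℝ)) '' {q : ℚ | (q : ℝ) < x})

lemma lt_extR (f : ℚ ≃o ℚ) (x : ℝ) (q : ℚ) : (f q : ℝ) < extR f x ↔ (q : ℝ) < x := by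
  constructor
  · intro h
    have hne : ((fun q : ℚ => (f q : ℝ)) '' {q : ℚ | (q : ℝ) < x}).Nonempty := by
      obtain ⟨p, hp⟩ := exists_rat_lt x
      exact ⟨_, p, hp, rfl⟩
    obtain ⟨_, ⟨p, hp, rfl⟩, h2⟩ := exists_lt_of_lt_csSup hne h
    beta_reduce at h2
    have h3 : q < p := f.lt_iff_lt.1 (by exact_mod_cast h2)
    exact lt_trans (by exact_mod_cast h3) hp
  · intro h
    obtain ⟨p, h1, h2⟩ := exists_rat_btwn h
    have h3 : f q < f p := f.lt_iff_lt.2 (by exact_mod_cast h1)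
    refine lt_of_lt_of_le (b := (f p : ℝ)) (by exact_mod_cast h3) (le_csSup ?_ ⟨p, h2, rfl⟩)
    obtain ⟨u, hu⟩ := exists_rat_gt x
    refine ⟨(f u : ℝ), ?_⟩
    rintro _ ⟨s, hs, rfl⟩
    have h4 : s < u := by exact_mod_cast lt_trans hs hu
    have h5 := (f.lt_iff_lt.2 h4).le
    beta_reduce
    exact_mod_cast h5

lemma le_of_ratCut (x y : ℝ) (h : ∀ q : ℚ, (q : ℝ) < x → (q : ℝ) < y) : x ≤ y := by
  by_contra hc
  obtain ⟨q, h1, h2⟩ := exists_rat_btwn (not_le.1 hc)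
  exact lt_asymm h1 (h q h2)

lemma eq_of_ratCut (f : ℚ ≃o ℚ) (x y : ℝ) (h : ∀ q : ℚ, (f q : ℝ) < x ↔ (f q : ℝ) < y) : x = y := by
  apply le_antisymm <;> apply le_of_ratCut <;> intro q hq <;>
    obtain ⟨p, rfl⟩ := f.surjective q
  · exact (h p).1 hq
  · exact (h p).2 hq

lemma extR_mul (f g : ℚ ≃o ℚ) (x : ℝ) : extR (f * g) x = extR f (extR g x) := by
  apply eq_of_ratCut (f * g)
  intro q
  rw [lt_extR, RelIso.mul_apply, lt_extR, lt_extR]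

lemma extR_one (x : ℝ) : extR 1 x = x := by
  apply eq_of_ratCut 1
  intro q
  rw [lt_extR, RelIso.one_apply]

lemma extR_rat (f : ℚ ≃o ℚ) (q : ℚ) : extR f q = f q := by
  apply eq_of_ratCut f
  intro p
  rw [lt_extR]
  norm_cast
  exact f.lt_iff_lt.symm

lemma extR_mono (f : ℚ ≃o ℚ) {x y : ℝ} (h : x ≤ y) : extR f x ≤ extR f y := by
  apply le_of_ratCut
  intro q hq
  obtain ⟨p, rfl⟩ := f.surjective q
  rw [lt_extR] at *
  exact lt_of_lt_of_le hq h

noncomputable def extIso (f : ℚ ≃o ℚ) : ℝ ≃o ℝ where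
  toFun := extR f
  invFun := extR f⁻¹
  left_inv x := by rw [← extR_mul, inv_mul_cancel, extR_one]
  right_inv x := by rw [← extR_mul, mul_inv_cancel, extR_one]
  map_rel_iff' := by
    intro x y
    refine ⟨fun h => ?_, extR_mono f⟩
    have := extR_mono f⁻¹ h
    simpa only [Equiv.coe_fn_mk, ← extR_mul, inv_mul_cancel, extR_one] using this

/-- A left-invariant order gives an action on the lexicographic product with `ℚ`. -/
def lexShift {G : Type*} [Group G] [LinearOrder G] (hm : ∀ f g h : G, g < h ↔ f * g < f * h)
    (a : G) : (G ×ₗ ℚ) ≃o (G ×ₗ ℚ) where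
  toFun p := toLex (a * (ofLex p).1, (ofLex p).2)
  invFun p := toLex (a⁻¹ * (ofLex p).1, (ofLex p).2)
  left_inv p := by simp
  right_inv p := by simp
  map_rel_iff' := by
    intro p q
    simp [Prod.Lex.le_iff, ← hm]

theorem dynamical_aux {G : Type*} [Group G] [Countable G] [LinearOrder G]
    (hm : ∀ f g h : G, g < h ↔ f * g < f * h) :
    ∃ ρ : G →* (ℝ ≃o ℝ), Function.Injective ρ ∧
      ∃ t : G → ℝ, (∀ a b : G, a < b ↔ t a < t b) ∧
        ∀ g h : G, ρ g (t h) = t (g * h) := by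
  have : Countable (G ×ₗ ℚ) := inferInstanceAs (Countable (G × ℚ))
  obtain ⟨e⟩ := Order.iso_of_countable_dense (G ×ₗ ℚ) ℚ
  let σ : G → (ℚ ≃o ℚ) := fun a => (e.symm.trans (lexShift hm a)).trans e
  have hσ : ∀ a b, σ (a * b) = σ a * σ b := by
    intro a b
    ext q
    simp [σ, lexShift, RelIso.mul_apply, mul_assoc]
  let ρ : G →* (ℝ ≃o ℝ) := MonoidHom.mk' (fun a => extIso (σ a)) (by
    intro a b
    ext x
    change extR (σ (a * b)) x = extR (σ a) (extR (σ b) x)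
    rw [hσ, extR_mul])
  let t : G → ℝ := fun h => ((e (toLex (h, 0)) : ℚ) : ℝ)
  have ht : ∀ a b : G, a < b ↔ t a < t b := by
    intro a b
    simp [t, Prod.Lex.lt_iff]
  have hρ : ∀ g h : G, ρ g (t h) = t (g * h) := by
    intro g h
    change extR (σ g) _ = _
    rw [extR_rat]
    simp [t, σ, lexShift]
  have hinj : Function.Injective t := by
    intro a b h
    rcases lt_trichotomy a b with h' | h' | h'
    · exact absurd h ((ht _ _).1 h').ne
    · exact h'
    · exact absurd h ((ht _ _).1 h').ne'
  refine ⟨ρ, ?_, t, ht, hρ⟩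
  intro a b h
  have h1 := hρ a 1
  rw [h, hρ b 1] at h1
  simpa using (hinj h1).symm

theorem dynamical_realisation {G : Type*} [Group G] [Countable G]
    (r : G → G → Prop) (hr : IsLeftOrder r) :
    ∃ ρ : G →* (ℝ ≃o ℝ), Function.Injective ρ ∧
      ∃ t : G → ℝ, (∀ a b : G, r a b ↔ t a < t b) ∧
        ∀ g h : G, ρ g (t h) = t (g * h) := by
  classical
  obtain ⟨h1, h2, h3, h4⟩ := hr
  letI : LinearOrder G :=
    { le := fun a b => a = b ∨ r a b
      lt := r
      le_refl := fun a => Or.inl rfl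
      le_trans := by
        rintro a b c (rfl | h) (rfl | h')
        · exact Or.inl rfl
        · exact Or.inr h'
        · exact Or.inr h
        · exact Or.inr (h2 _ _ _ h h')
      lt_iff_le_not_ge := by
        intro a b
        constructor
        · intro h
          refine ⟨Or.inr h, ?_⟩
          rintro (rfl | h')
          · exact h1 _ h
          · exact h1 _ (h2 _ _ _ h h')
        · rintro ⟨rfl | h, h'⟩
          · exact absurd (Or.inl rfl) h'
          · exact h
      le_antisymm := by
        rintro a b (h | h) (h' | h')
        · exact h
        · exact h
        · exact h'.symm
        · exact absurd (h2 _ _ _ h h') (h1 _)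
      le_total := by
        intro a b
        by_cases h : a = b
        · exact Or.inl (Or.inl h)
        · exact (h3 a b h).imp Or.inr Or.inr
      toDecidableLE := Classical.decRel _ }
  exact dynamical_aux (G := G) h4
end

section
/- For any left-orderable group G, the space LO(G) of positive cones of G is a closed subset of the product space ∏_{g ∈ G∖{1}} {0,1}; consequently LO(G) is compact, and it is totally disconnected. -/
/-- The indicator function of a subset `P ⊆ G`, as a point of the product space
`∏_{g ∈ G∖{1}} {0,1}` (with each factor discrete and the product topology). -/
noncomputable def coneChar {G : Type*} [Group G] (P : Set G) : {g : G // g ≠ 1} → Bool :=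
  fun g => @decide ((g : G) ∈ P) (Classical.dec _)

/-- The space `LO(G)` of positive cones of `G`, viewed as a subset of the product space
`∏_{g ∈ G∖{1}} {0,1}` via indicator functions. -/
noncomputable def LOSpace (G : Type*) [Group G] : Set ({g : G // g ≠ 1} → Bool) :=
  {f | ∃ P : Set G, IsPositiveCone P ∧ f = coneChar P}

theorem LOSpace_eq_aux (G : Type*) [Group G] : LOSpace G =
    (⋂ (a : {g : G // g ≠ 1}) (b : {g : G // g ≠ 1}) (c : {g : G // g ≠ 1})
      (_ : (a : G) * b = c), {f | (f a && f b && !f c) = false}) ∩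
    (⋂ (a : {g : G // g ≠ 1}) (b : {g : G // g ≠ 1}) (_ : (a : G) * b = 1),
      {f | f a = !f b}) := by
  ext f
  simp only [Set.mem_inter_iff, Set.mem_iInter, Set.mem_ofPred_eq]
  constructor
  · rintro ⟨P, ⟨h1, h2, h3, h4⟩, rfl⟩
    refine ⟨?_, ?_⟩
    · intro a b c h
      have := h1 a.1
      by_cases ha : (a : G) ∈ P <;> by_cases hb : (b : G) ∈ P <;> simp [coneChar, ha, hb]
      rw [← h]
      exact h1 _ ha _ hb
    · intro a b h
      have hb : (b : G) = (a : G)⁻¹ := (inv_eq_of_mul_eq_one_right h).symm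
      by_cases ha : (a : G) ∈ P
      · have := h4 _ ha
        simp [coneChar, ha, hb, this]
      · have := ((h2 a).resolve_left ha).resolve_right a.2
        simp [coneChar, ha, hb, this]
  · rintro ⟨h1, h2⟩
    refine ⟨{g | ∃ h : g ≠ 1, f ⟨g, h⟩ = true}, ⟨?_, ?_, ?_, ?_⟩, ?_⟩
    · rintro a ⟨ha, fa⟩ b ⟨hb, fb⟩
      have hab : a * b ≠ 1 := by
        intro h
        have := h2 ⟨a, ha⟩ ⟨b, hb⟩ h
        simp [fa, fb] at this
      refine ⟨hab, ?_⟩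
      have := h1 ⟨a, ha⟩ ⟨b, hb⟩ ⟨a * b, hab⟩ rfl
      simpa [fa, fb] using this
    · intro g
      by_cases hg : g = 1
      · exact Or.inr (Or.inr hg)
      · have hi : g⁻¹ ≠ 1 := inv_ne_one.mpr hg
        have := h2 ⟨g, hg⟩ ⟨g⁻¹, hi⟩ (mul_inv_cancel g)
        cases hf : f ⟨g⁻¹, hi⟩
        · left
          exact ⟨hg, by simpa [hf] using this⟩
        · right; left
          exact ⟨hi, hf⟩
    · rintro ⟨h, _⟩
      exact h rfl
    · rintro g ⟨hg, fg⟩ ⟨hi, fi⟩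
      have := h2 ⟨g, hg⟩ ⟨g⁻¹, hi⟩ (mul_inv_cancel g)
      simp [fg, fi] at this
    · funext g
      obtain ⟨g, hg⟩ := g
      cases hf : f ⟨g, hg⟩ <;> simp [coneChar, hf, hg]

/-- For any group `G`, the space `LO(G)` of positive cones is closed in the product space
`∏_{g ∈ G∖{1}} {0,1}`; consequently it is compact, and it is totally disconnected. -/
theorem LOSpace_closed_compact_totallyDisconnected (G : Type*) [Group G] :
    IsClosed (LOSpace G) ∧ IsCompact (LOSpace G) ∧
      IsTotallyDisconnected (LOSpace G) := by
  have hc : IsClosed (LOSpace G) := by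
    rw [LOSpace_eq_aux]
    refine IsClosed.inter ?_ ?_
    · refine isClosed_iInter fun a => isClosed_iInter fun b => isClosed_iInter fun c =>
        isClosed_iInter fun _ => ?_
      have hk : Continuous fun p : Bool × Bool × Bool => (p.1 && p.2.1 && !p.2.2) :=
        continuous_of_discreteTopology
      have hg : Continuous fun f : {g : G // g ≠ 1} → Bool => (f a, f b, f c) :=
        (continuous_apply a).prodMk ((continuous_apply b).prodMk (continuous_apply c))
      have hh : Continuous fun f : {g : G // g ≠ 1} → Bool => (f a && f b && !f c) :=
        hk.comp hg
      exact isClosed_eq hh continuous_const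
    · refine isClosed_iInter fun a => isClosed_iInter fun b => isClosed_iInter fun _ => ?_
      have hk : Continuous fun p : Bool => !p := continuous_of_discreteTopology
      exact isClosed_eq (continuous_apply a) (hk.comp (continuous_apply b))
  exact ⟨hc, hc.isCompact, isTotallyDisconnected_of_totallyDisconnectedSpace _⟩
end

section
/- A group G is left-orderable if and only if for every finite subset {g₁, …, g_n} of G not containing the identity, there exist signs ε₁, …, ε_n ∈ {1, -1} such that the identity element 1 does not belong to the subsemigroup ⟨g₁^{ε₁}, …, g_n^{ε_n}⟩⁺ generated by g₁^{ε₁}, …, g_n^{ε_n}. -/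
/-- A group `G` is left-orderable iff for every finite subset `{g₁, …, gₙ}` of `G` not
containing the identity there are signs `εᵢ ∈ {1, -1}` such that `1` does not lie in the
subsemigroup generated by `g₁^{ε₁}, …, gₙ^{εₙ}`. -/
theorem leftOrderable_iff_signs {G : Type*} [Group G] :
    (∃ r : G → G → Prop, IsLeftOrder r) ↔
      ∀ S : Finset G, (1 : G) ∉ S →
        ∃ ε : G → ℤ, (∀ g ∈ S, ε g = 1 ∨ ε g = -1) ∧
          (1 : G) ∉ Subsemigroup.closure ((fun g : G => g ^ ε g) '' (S : Set G)) := by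
  classical
  constructor
  · rintro ⟨r, hirr, htr, htot, hinv⟩ S hS
    refine ⟨fun g => if r 1 g then 1 else -1, ?_, ?_⟩
    · intro g _
      by_cases h : r 1 g <;> simp [h]
    · intro h1
      have key : ∀ x ∈ Subsemigroup.closure
          ((fun g : G => g ^ (if r 1 g then (1 : ℤ) else -1)) '' (S : Set G)), r 1 x := by
        intro x hx
        induction hx using Subsemigroup.closure_induction with
        | mem x hx =>
          obtain ⟨g, hg, rfl⟩ := hx
          by_cases h : r 1 g
          · simpa [h] using h
          · have hne : (1 : G) ≠ g := fun e => hS (e ▸ hg)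
            have h2 : r g 1 := (htot 1 g hne).resolve_left h
            have h3 := (hinv g⁻¹ g 1).1 h2
            simpa [h] using h3
        | mul x y _ _ hx hy =>
          have h3 := (hinv x 1 y).1 hy
          rw [mul_one] at h3
          exact htr _ _ _ hx h3
      exact hirr 1 (key 1 h1)
  · intro H
    choose! ε hε h1 using H
    let C : Finset G → Subsemigroup G := fun S =>
      Subsemigroup.closure ((fun g : G => g ^ ε (S.erase 1) g) '' ((S.erase 1 : Finset G) : Set G))
    have hC1 : ∀ S, (1 : G) ∉ C S := fun S => h1 _ (Finset.notMem_erase 1 S)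
    have hC : ∀ S, ∀ g ∈ S, g ≠ 1 → g ∈ C S ∨ g⁻¹ ∈ C S := by
      intro S g hg hne
      have hm : g ∈ S.erase 1 := Finset.mem_erase.2 ⟨hne, hg⟩
      have hc : g ^ ε (S.erase 1) g ∈ C S :=
        Subsemigroup.subset_closure ⟨g, hm, rfl⟩
      rcases hε _ (Finset.notMem_erase 1 S) g hm with h | h
      · left; simpa [h] using hc
      · right; simpa [h] using hc
    let U : Ultrafilter (Finset G) := Ultrafilter.of Filter.atTop
    have hU : (U : Filter (Finset G)) ≤ Filter.atTop := Ultrafilter.of_le _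
    refine ⟨fun a b => ∀ᶠ S in (U : Filter (Finset G)), a⁻¹ * b ∈ C S, ?_, ?_, ?_, ?_⟩
    · intro g h
      obtain ⟨S, hS⟩ := h.exists
      exact hC1 S (by simpa using hS)
    · intro a b c h h'
      filter_upwards [h, h'] with S hS hS'
      have := (C S).mul_mem hS hS'
      simpa [mul_assoc] using this
    · intro a b hab
      rw [← Ultrafilter.eventually_or]
      have hne : a⁻¹ * b ≠ 1 := fun e => hab (inv_mul_eq_one.1 e)
      have hev := hU (Filter.eventually_ge_atTop ({a⁻¹ * b} : Finset G))
      filter_upwards [hev] with S hS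
      have := hC S (a⁻¹ * b) (hS (Finset.mem_singleton_self _)) hne
      simpa using this
    · intro f g h
      have : (f * g)⁻¹ * (f * h) = g⁻¹ * h := by group
      simp only [this]
end
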